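/- For every finite-dimensional linear subspace D of ℓ^∞ with D ∩ c = {0}, there exists a closed linear subspace Z of ℓ^∞ with D ⊆ Z, Z ∩ c = {0}, and the algebraic dimension of Z equal to the cardinality of the continuum 𝔠. In particular, ℓ^∞ \ c is (r, 𝔠)-spaceable for every r ∈ ℕ. -/

import Mathlib

open Filter Topology

noncomputable section

/-- `ℓ^∞`: the Banach space of bounded real sequences with the sup norm. -/
abbrev Linfty : Type := lp (fun _ : ℕ => ℝ) ⊤

/-- `c`: the set of convergent sequences inside `ℓ^∞`. -/
def convSeq : Set Linfty := {f | ∃ l : ℝ, Tendsto (fun n => (f : ℕ → ℝ) n) atTop (𝓝 l)}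

/-- `A ⊆ ℓ^∞` is `(α, β)`-spaceable: `A ∪ {0}` contains an `α`-dimensional subspace,
and every `α`-dimensional subspace contained in `A ∪ {0}` is contained in a closed
`β`-dimensional subspace contained in `A ∪ {0}`. -/
def IsSpaceable (α β : Cardinal) (A : Set Linfty) : Prop :=
  (∃ W : Submodule ℝ Linfty, Module.rank ℝ W = α ∧ (W : Set Linfty) ⊆ A ∪ {0}) ∧
  ∀ W : Submodule ℝ Linfty, Module.rank ℝ W = α → (W : Set Linfty) ⊆ A ∪ {0} →
    ∃ Z : Submodule ℝ Linfty, IsClosed (Z : Set Linfty) ∧ Module.rank ℝ Z = β ∧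
      W ≤ Z ∧ (Z : Set Linfty) ⊆ A ∪ {0}

open Cardinal in
/-- The sequences `(tⁿ)` with `0 < t < 1` are linearly independent, so `ℓ^∞` has dimension at
least `𝔠`. -/
theorem continuum_le_rank_linfty : 𝔠 ≤ Module.rank ℝ Linfty := by
  have hmem (t : Set.Ioo (0 : ℝ) 1) : Memℓp (fun n : ℕ => (t : ℝ) ^ n) ⊤ :=
    memℓp_infty ⟨1, by
      rintro _ ⟨n, rfl⟩
      simpa [abs_of_pos t.2.1] using pow_le_one₀ t.2.1.le t.2.2.le⟩
  let v : Set.Ioo (0 : ℝ) 1 → Linfty := fun t => ⟨fun n => (t : ℝ) ^ n, hmem t⟩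
  let coe : Linfty →ₗ[ℝ] (ℕ → ℝ) := LinearMap.pi fun n => lp.evalₗ (fun _ : ℕ => ℝ) ⊤ n
  have hli : LinearIndependent ℝ (coe ∘ v) := by
    refine Module.End.eigenvectors_linearIndependent' (LinearMap.funLeft ℝ ℝ Nat.succ)
      (fun t : Set.Ioo (0 : ℝ) 1 => (t : ℝ)) Subtype.coe_injective _ fun t => ?_
    refine Module.End.hasEigenvector_iff.2 ⟨Module.End.mem_eigenspace_iff.2 ?_, fun h => ?_⟩
    · ext n
      exact pow_succ' (t : ℝ) n
    · exact one_ne_zero ((pow_zero (t : ℝ)).symm.trans (congrFun h 0))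
  simpa [mk_Ioo_real one_pos] using (LinearIndependent.of_comp coe hli).cardinal_le_rank

theorem rank_submodule_linfty_le (Z : Submodule ℝ Linfty) :
    Module.rank ℝ Z ≤ Cardinal.continuum := by
  refine (rank_le_card ℝ Z).trans ?_
  have hinj : Function.Injective fun z : Z => ((z : Linfty) : ℕ → ℝ) :=
    fun x y h => Subtype.ext (lp.ext h)
  refine (Cardinal.mk_le_of_injective hinj).trans_eq ?_
  rw [← Cardinal.power_def, Cardinal.mk_real, Cardinal.mk_nat, Cardinal.continuum_power_aleph0]

/-- The bounded sequence whose `n`-th entry is `a k` if `g n = some k` and `0` if `g n = none`. -/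
def spread (g : ℕ → Option ℕ) : Linfty →ₗ[ℝ] Linfty where
  toFun a := ⟨fun n => (g n).elim 0 a, memℓp_infty ⟨‖a‖, by
    rintro _ ⟨n, rfl⟩
    cases h : g n with
    | none => simp [h]
    | some k => simpa [h] using lp.norm_apply_le_norm ENNReal.top_ne_zero a k⟩⟩
  map_add' a b := by
    ext n
    change (g n).elim 0 (a + b : Linfty) = (g n).elim 0 a + (g n).elim 0 b
    cases g n with
    | none => exact (add_zero 0).symm
    | some k => rfl
  map_smul' r a := by
    ext n
    change (g n).elim 0 (r • a : Linfty) = r * (g n).elim 0 a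
    cases g n <;> simp

theorem spread_apply (g : ℕ → Option ℕ) (a : Linfty) (n : ℕ) :
    spread g a n = (g n).elim 0 a := rfl

theorem norm_spread {g : ℕ → Option ℕ} (hg : ∀ k, ∃ n, g n = some k) (a : Linfty) :
    ‖spread g a‖ = ‖a‖ := by
  apply le_antisymm
  · refine lp.norm_le_of_forall_le (norm_nonneg _) fun n => ?_
    rw [spread_apply]
    cases g n with
    | none => simp
    | some k => exact lp.norm_apply_le_norm ENNReal.top_ne_zero a k
  · refine lp.norm_le_of_forall_le (norm_nonneg _) fun k => ?_
    obtain ⟨n, hn⟩ := hg k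
    simpa [spread_apply, hn] using lp.norm_apply_le_norm ENNReal.top_ne_zero (spread g a) n

/-- A bounded sequence of functionals on a finite-dimensional space has a pointwise convergent
subsequence. -/
theorem exists_subseq_tendsto_apply {E : Type*} [NormedAddCommGroup E] [NormedSpace ℝ E]
    [FiniteDimensional ℝ E] (u : ℕ → E →L[ℝ] ℝ) (hu : ∀ n x, ‖u n x‖ ≤ ‖x‖) :
    ∃ σ : ℕ → ℕ, StrictMono σ ∧
      ∀ x, ∃ l : ℝ, Tendsto (fun n => u (σ n) x) atTop (𝓝 l) := by
  have hmem (n : ℕ) : u n ∈ Metric.closedBall (0 : E →L[ℝ] ℝ) 1 := by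
    rw [mem_closedBall_zero_iff]
    exact ContinuousLinearMap.opNorm_le_bound _ zero_le_one fun x => by simpa using hu n x
  have : ProperSpace (E →L[ℝ] ℝ) := FiniteDimensional.proper ℝ _
  obtain ⟨L, -, σ, hσ, hL⟩ := tendsto_subseq_of_bounded Metric.isBounded_closedBall hmem
  exact ⟨σ, hσ, fun x =>
    ⟨L x, ((ContinuousLinearMap.apply ℝ ℝ x).continuous.tendsto L).comp hL⟩⟩

/-- The elements of a finite-dimensional subspace of `ℓ^∞` converge along a common subsequence. -/
theorem exists_common_convergent_subseq (D : Submodule ℝ Linfty) [FiniteDimensional ℝ D] :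
    ∃ σ : ℕ → ℕ, StrictMono σ ∧
      ∀ d ∈ D, ∃ l : ℝ, Tendsto (fun n => d (σ n)) atTop (𝓝 l) := by
  obtain ⟨σ, hσ, h⟩ := exists_subseq_tendsto_apply
    (fun n => (lp.evalCLM ℝ (fun _ : ℕ => ℝ) ⊤ n).comp D.subtypeL)
    fun n d => lp.norm_apply_le_norm ENNReal.top_ne_zero (d : Linfty) n
  exact ⟨σ, hσ, fun d hd => h ⟨d, hd⟩⟩

/-- A labelling of `ℕ` in which every label in `Option ℕ` occurs infinitely often along `σ`. -/
theorem exists_labelling {σ : ℕ → ℕ} (hσ : StrictMono σ) :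
    ∃ g : ℕ → Option ℕ, ∀ o : Option ℕ, ∃ τ : ℕ → ℕ, Tendsto τ atTop atTop ∧
      ∀ j, g (σ (τ j)) = o := by
  let e : ℕ ≃ Option ℕ := (Denumerable.eqv (Option ℕ)).symm
  refine ⟨Function.extend σ (fun n => e n.unpair.1) fun _ => none, fun o =>
    ⟨fun j => Nat.pair (e.symm o) j,
      tendsto_atTop_mono (fun j => Nat.right_le_pair _ j) tendsto_id, fun j => ?_⟩⟩
  rw [hσ.injective.extend_apply]
  simp

theorem zero_mem_convSeq : (0 : Linfty) ∈ convSeq := ⟨0, tendsto_const_nhds⟩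

theorem exists_closed_superspace (D : Submodule ℝ Linfty) [FiniteDimensional ℝ D]
    (hD : (D : Set Linfty) ∩ convSeq = {0}) :
    ∃ Z : Submodule ℝ Linfty, IsClosed (Z : Set Linfty) ∧ D ≤ Z ∧
      (Z : Set Linfty) ∩ convSeq = {0} ∧ Module.rank ℝ Z = Cardinal.continuum := by
  obtain ⟨σ, hσ, hconv⟩ := exists_common_convergent_subseq D
  obtain ⟨g, hg⟩ := exists_labelling hσ
  let T : Linfty →ₗᵢ[ℝ] Linfty := ⟨spread g, norm_spread fun k => by
    obtain ⟨τ, -, hτ⟩ := hg (some k)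
    exact ⟨_, hτ 0⟩⟩
  have hclosed : IsClosed (LinearMap.range T.toLinearMap : Set Linfty) :=
    T.isometry.isClosedEmbedding.isClosed_range
  refine ⟨LinearMap.range T.toLinearMap ⊔ D, Submodule.isClosed_sup_finiteDimensional _ _ hclosed,
    le_sup_right, ?_, le_antisymm (rank_submodule_linfty_le _) ?_⟩
  · refine Set.eq_singleton_iff_unique_mem.2 ⟨⟨zero_mem _, zero_mem_convSeq⟩, ?_⟩
    rintro z ⟨hz, l, hl⟩
    obtain ⟨_, ⟨a, rfl⟩, d, hd, rfl⟩ := Submodule.mem_sup.1 hz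
    obtain ⟨m, hm⟩ := hconv d hd
    have hlim : Tendsto (fun n => spread g a (σ n)) atTop (𝓝 (l - m)) := by
      refine ((hl.comp hσ.tendsto_atTop).sub hm).congr fun n => ?_
      exact add_sub_cancel_right (spread g a (σ n)) (d (σ n))
    have hval (o : Option ℕ) : o.elim 0 a = l - m := by
      obtain ⟨τ, hτ, hgo⟩ := hg o
      refine tendsto_nhds_unique (tendsto_const_nhds.congr fun j => ?_) (hlim.comp hτ)
      simp only [Function.comp_apply, spread_apply, hgo]
    have ha : a = 0 := lp.ext (funext fun k => (hval (some k)).trans (hval none).symm)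
    subst ha
    rw [map_zero, zero_add] at hl ⊢
    exact hD.subset ⟨hd, l, hl⟩
  · calc Cardinal.continuum ≤ Module.rank ℝ Linfty := continuum_le_rank_linfty
      _ = Module.rank ℝ (LinearMap.range T.toLinearMap) :=
        (LinearEquiv.ofInjective T.toLinearMap T.injective).rank_eq
      _ ≤ _ := Submodule.rank_mono le_sup_left

theorem subset_compl_union_zero_iff (W : Submodule ℝ Linfty) :
    (W : Set Linfty) ⊆ (Set.univ \ convSeq) ∪ {0} ↔ (W : Set Linfty) ∩ convSeq = {0} := by
  constructor
  · refine fun h => Set.eq_singleton_iff_unique_mem.2 ⟨⟨W.zero_mem, zero_mem_convSeq⟩, ?_⟩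
    rintro x ⟨hx, hc⟩
    exact (h hx).resolve_left fun hn => hn.2 hc
  · intro h x hx
    by_cases hc : x ∈ convSeq
    · exact Or.inr (h.subset ⟨hx, hc⟩)
    · exact Or.inl ⟨trivial, hc⟩

/-- Every finite-dimensional `D ⊆ ℓ^∞` with `D ∩ c = {0}` is contained in a closed
subspace `Z` of algebraic dimension `𝔠` with `Z ∩ c = {0}`; in particular
`ℓ^∞ \ c` is `(r, 𝔠)`-spaceable for every `r ∈ ℕ`. -/
theorem stmt13 :
    (∀ D : Submodule ℝ Linfty, FiniteDimensional ℝ D →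
      (D : Set Linfty) ∩ convSeq = {0} →
      ∃ Z : Submodule ℝ Linfty, IsClosed (Z : Set Linfty) ∧ D ≤ Z ∧
        (Z : Set Linfty) ∩ convSeq = {0} ∧ Module.rank ℝ Z = Cardinal.continuum) ∧
    (∀ r : ℕ, IsSpaceable (r : Cardinal) Cardinal.continuum
      ((Set.univ : Set Linfty) \ convSeq)) := by
  refine ⟨fun D _ hD => exists_closed_superspace D hD, fun r => ⟨?_, fun W hr hW => ?_⟩⟩
  · obtain ⟨Z, -, -, hZ, hrank⟩ := exists_closed_superspace ⊥
      (Set.inter_eq_left.2 (by simpa using zero_mem_convSeq))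
    obtain ⟨f, hf⟩ := (Module.le_rank_iff_exists_linearMap (n := r)).1
      ((Cardinal.nat_lt_continuum r).le.trans_eq hrank.symm)
    have hinj : Function.Injective (Z.subtype ∘ₗ f) := Z.injective_subtype.comp hf
    refine ⟨LinearMap.range (Z.subtype ∘ₗ f), ?_, ?_⟩
    · rw [← (LinearEquiv.ofInjective _ hinj).rank_eq]
      simp
    · rintro _ ⟨x, rfl⟩
      exact (subset_compl_union_zero_iff Z).2 hZ (f x).2
  · have : FiniteDimensional ℝ W :=
      IsNoetherian.iff_fg.1 <| IsNoetherian.iff_rank_lt_aleph0.2 <|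
        hr.trans_lt Cardinal.natCast_lt_aleph0
    obtain ⟨Z, hcl, hle, hZ, hrank⟩ :=
      exists_closed_superspace W ((subset_compl_union_zero_iff W).1 hW)
    exact ⟨Z, hcl, hrank, hle, (subset_compl_union_zero_iff Z).2 hZ⟩
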